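/- arXiv:2403.06219 — 2 statements merged into one kernel-verified Lean document; each statement's English description precedes it below -/
import Mathlib

section
/- Let S be an additive commutative monoid admitting an injective additive monoid homomorphism φ : S → ℕ, and let f : S → M₁ and g : S → M₂ be injective additive monoid homomorphisms into positive cancellative additive commutative monoids M₁ and M₂. If s₁, t₁ ∈ M₁, s₂, t₂ ∈ M₂ and a, b ∈ S satisfy s₁ + t₁ + f(a) = f(b) in M₁ and s₂ + t₂ + g(b) = g(a) in M₂, then s₁ = t₁ = 0 and s₂ = t₂ = 0. -/
/-- If `S` embeds into `ℕ` via `φ` and into a positive cancellative monoid via `f`, then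
divisibility `x + f a = f b` in the target forces `φ a ≤ φ b`. -/
theorem map_le_map_of_add_map_eq
    {S M : Type*} [AddCommMonoid S] [AddCommMonoid M]
    (φ : S →+ ℕ) (hφ : Function.Injective φ) (f : S →+ M) (hf : Function.Injective f)
    (hcancel : ∀ x y z : M, x + z = y + z → x = y)
    (hpos : ∀ x y : M, x + y = 0 → x = 0)
    {x : M} {a b : S} (h : x + f a = f b) : φ a ≤ φ b := by
  by_contra! hlt
  obtain ⟨k, hk⟩ := Nat.exists_eq_add_of_lt hlt
  have hab : φ b • a = φ a • b := hφ (by simp [mul_comm])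
  have hfab : φ b • f a = φ a • f b := by simpa using congrArg f hab
  have hsum : f a + (k • f a + φ a • x) = 0 := by
    apply hcancel _ _ (φ b • f a)
    calc f a + (k • f a + φ a • x) + φ b • f a
        = φ a • x + (φ b + k + 1) • f a := by
          rw [add_nsmul, add_nsmul, one_nsmul]; abel
      _ = φ a • x + φ a • f a := by rw [← hk]
      _ = 0 + φ b • f a := by rw [← nsmul_add, h, zero_add, hfab]
  have ha : a = 0 := hf ((hpos _ _ hsum).trans (map_zero f).symm)
  simp [ha] at hlt

/-- Let `S` embed into `ℕ` and let `f : S →+ M₁`, `g : S →+ M₂` be injective homomorphisms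
into positive cancellative additive commutative monoids.  If `s₁ + t₁ + f a = f b` and
`s₂ + t₂ + g b = g a`, then `s₁ = t₁ = 0` and `s₂ = t₂ = 0` (positivity of the fibered
sum over a numerical semigroup). -/
theorem fiberedSum_positive_of_numerical
    {S M₁ M₂ : Type*} [AddCommMonoid S] [AddCommMonoid M₁] [AddCommMonoid M₂]
    (φ : S →+ ℕ) (hφ : Function.Injective φ)
    (f : S →+ M₁) (hf : Function.Injective f)
    (g : S →+ M₂) (hg : Function.Injective g)
    (hcancel₁ : ∀ x y z : M₁, x + z = y + z → x = y)
    (hcancel₂ : ∀ x y z : M₂, x + z = y + z → x = y)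
    (hpos₁ : ∀ x y : M₁, x + y = 0 → x = 0)
    (hpos₂ : ∀ x y : M₂, x + y = 0 → x = 0)
    (s₁ t₁ : M₁) (s₂ t₂ : M₂) (a b : S)
    (h₁ : s₁ + t₁ + f a = f b) (h₂ : s₂ + t₂ + g b = g a) :
    s₁ = 0 ∧ t₁ = 0 ∧ s₂ = 0 ∧ t₂ = 0 := by
  have hab : a = b := hφ (le_antisymm
    (map_le_map_of_add_map_eq φ hφ f hf hcancel₁ hpos₁ h₁)
    (map_le_map_of_add_map_eq φ hφ g hg hcancel₂ hpos₂ h₂))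
  subst hab
  have hs₁ : s₁ + t₁ = 0 := hcancel₁ _ _ (f a) (by rw [h₁, zero_add])
  have hs₂ : s₂ + t₂ = 0 := hcancel₂ _ _ (g a) (by rw [h₂, zero_add])
  exact ⟨hpos₁ _ _ hs₁, hpos₁ _ _ ((add_comm _ _).trans hs₁),
    hpos₂ _ _ hs₂, hpos₂ _ _ ((add_comm _ _).trans hs₂)⟩
end

section
/- Let κ be a field, d a positive integer, and S₁, S₂ additive submonoids of ℕ^d. Suppose there is a nonzero element w ∈ S₁ ∩ S₂ such that gp(S₁) ⊓ gp(S₂) = gp({w}) as subgroups of ℤ^d, and let A = {n•w : n ∈ ℕ} be the submonoid generated by w. Then there is a κ-algebra isomorphism from the tensor product (AddMonoidAlgebra κ S₁) ⊗_{AddMonoidAlgebra κ A} (AddMonoidAlgebra κ S₂) onto AddMonoidAlgebra κ (S₁ ⊔ S₂), where S₁ ⊔ S₂ = S₁ + S₂ is the submonoid of ℕ^d generated by S₁ and S₂, the algebra structures are induced by the inclusions A ⊆ S₁ and A ⊆ S₂, and the isomorphism sends u^x ⊗ u^y to u^{x+y} for x ∈ S₁, y ∈ S₂. -/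
open scoped TensorProduct

/-- The coordinatewise inclusion `ℕ^d →+ ℤ^d`. -/
def natToInt (d : ℕ) : (Fin d → ℕ) →+ (Fin d → ℤ) where
  toFun v := fun k => (v k : ℤ)
  map_zero' := by funext k; simp
  map_add' x y := by funext k; simp

namespace AddMonoidAlgebra

variable {κ A M₁ M₂ N : Type*} [CommSemiring κ]
  [AddCommMonoid A] [AddCommMonoid M₁] [AddCommMonoid M₂] [AddCommMonoid N]
  {_ : Algebra (AddMonoidAlgebra κ A) (AddMonoidAlgebra κ M₁)}
  {_ : Algebra (AddMonoidAlgebra κ A) (AddMonoidAlgebra κ M₂)}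
  {_ : Algebra (AddMonoidAlgebra κ A) (AddMonoidAlgebra κ N)}
  {i₁ : A →+ M₁} {i₂ : A →+ M₂}

/-- A monomial of the base moves across the tensor product. -/
lemma single_add_tmul_single
    (h₁ : algebraMap (AddMonoidAlgebra κ A) (AddMonoidAlgebra κ M₁) = mapDomainRingHom κ i₁)
    (h₂ : algebraMap (AddMonoidAlgebra κ A) (AddMonoidAlgebra κ M₂) = mapDomainRingHom κ i₂)
    (a : A) (x : M₁) (y : M₂) (r s t : κ) :
    (single (i₁ a + x) (r * s) ⊗ₜ[AddMonoidAlgebra κ A] single y t :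
      AddMonoidAlgebra κ M₁ ⊗[AddMonoidAlgebra κ A] AddMonoidAlgebra κ M₂) =
      single x s ⊗ₜ single (i₂ a + y) (r * t) := by
  simpa [Algebra.smul_def, h₁, h₂, single_mul_single] using
    TensorProduct.smul_tmul (single a r : AddMonoidAlgebra κ A) (single x s : AddMonoidAlgebra κ M₁)
      (single y t : AddMonoidAlgebra κ M₂)

/-- If any two decompositions of an element of `N` as a sum from `M₁` and `M₂` differ by
transferring an element of `A`, then the monoid algebra of `N` is the tensor product of the
monoid algebras of `M₁` and `M₂` over that of `A`. -/
theorem exists_tensorProduct_algEquiv {j₁ : M₁ →+ N} {j₂ : M₂ →+ N}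
    (h₁ : algebraMap (AddMonoidAlgebra κ A) (AddMonoidAlgebra κ M₁) = mapDomainRingHom κ i₁)
    (h₂ : algebraMap (AddMonoidAlgebra κ A) (AddMonoidAlgebra κ M₂) = mapDomainRingHom κ i₂)
    (h : algebraMap (AddMonoidAlgebra κ A) (AddMonoidAlgebra κ N) =
      mapDomainRingHom κ (j₁.comp i₁))
    (hij : j₁.comp i₁ = j₂.comp i₂)
    (hsurj : ∀ n, ∃ x y, j₁ x + j₂ y = n)
    (hrel : ∀ x x' y y', j₁ x + j₂ y = j₁ x' + j₂ y' →
      ∃ a, (x = i₁ a + x' ∧ y' = i₂ a + y) ∨ (x' = i₁ a + x ∧ y = i₂ a + y')) :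
    ∃ e : AddMonoidAlgebra κ M₁ ⊗[AddMonoidAlgebra κ A] AddMonoidAlgebra κ M₂
        ≃ₐ[AddMonoidAlgebra κ A] AddMonoidAlgebra κ N,
      ∀ x y, e (single x 1 ⊗ₜ single y 1) = single (j₁ x + j₂ y) 1 := by
  let f₁ : AddMonoidAlgebra κ M₁ →ₐ[AddMonoidAlgebra κ A] AddMonoidAlgebra κ N :=
    { mapDomainRingHom κ j₁ with
      commutes' := fun p => by simp [h, h₁] }
  let f₂ : AddMonoidAlgebra κ M₂ →ₐ[AddMonoidAlgebra κ A] AddMonoidAlgebra κ N :=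
    { mapDomainRingHom κ j₂ with
      commutes' := fun p => by simp [h, h₂, hij] }
  let f := Algebra.TensorProduct.productMap f₁ f₂
  have hf (x y) (r s : κ) : f (single x r ⊗ₜ single y s) = single (j₁ x + j₂ y) (r * s) := by
    have e₁ : f₁ (single x r) = single (j₁ x) r := mapDomain_single
    have e₂ : f₂ (single y s) = single (j₂ y) s := mapDomain_single
    rw [Algebra.TensorProduct.productMap_apply_tmul, e₁, e₂, single_mul_single]
  choose p q hpq using hsurj
  let g : AddMonoidAlgebra κ N →+
      AddMonoidAlgebra κ M₁ ⊗[AddMonoidAlgebra κ A] AddMonoidAlgebra κ M₂ :=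
    (Finsupp.liftAddHom fun n =>
      ((TensorProduct.mk (AddMonoidAlgebra κ A) _ _).flip (single (q n) 1)).toAddMonoidHom.comp
        (singleAddHom (p n))).comp coeffAddEquiv.toAddMonoidHom
  have hg (n) (r : κ) : g (single n r) = single (p n) r ⊗ₜ single (q n) 1 := by
    simp [g]
  have move (a x y) (r s t : κ) := single_add_tmul_single h₁ h₂ a x y r s t
  have hgf : Function.LeftInverse g f := by
    intro z
    induction z using TensorProduct.induction_on with
    | zero => simp
    | add z z' hz hz' => rw [map_add, map_add, hz, hz']
    | tmul u v =>
      induction u using induction_linear with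
      | zero => simp
      | add u u' hu hu' => rw [TensorProduct.add_tmul, map_add, map_add, hu, hu']
      | single x r =>
        induction v using induction_linear with
        | zero => simp
        | add v v' hv hv' => rw [TensorProduct.tmul_add, map_add, map_add, hv, hv']
        | single y s =>
          rw [hf, hg]
          have hs := move 0 x y s r 1
          rw [map_zero, map_zero, zero_add, zero_add, mul_one, mul_comm] at hs
          rw [← hs]
          obtain ⟨a, ⟨hx, hy⟩ | ⟨hx, hy⟩⟩ := hrel _ _ _ _ (hpq (j₁ x + j₂ y))
          · have := move a x (q (j₁ x + j₂ y)) 1 (r * s) 1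
            rwa [one_mul, one_mul, ← hx, ← hy] at this
          · have := move a (p (j₁ x + j₂ y)) y 1 (r * s) 1
            rw [one_mul, one_mul, ← hx, ← hy] at this
            exact this.symm
  have hfs : Function.Surjective f := by
    intro z
    induction z using induction_linear with
    | zero => exact ⟨0, map_zero f⟩
    | add z z' hz hz' =>
      obtain ⟨u, rfl⟩ := hz
      obtain ⟨v, rfl⟩ := hz'
      exact ⟨u + v, map_add f u v⟩
    | single n r => exact ⟨single (p n) r ⊗ₜ single (q n) 1, by rw [hf, hpq, mul_one]⟩
  exact ⟨AlgEquiv.ofBijective f ⟨hgf.injective, hfs⟩,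
    fun x y => (hf x y 1 1).trans (by rw [mul_one])⟩

end AddMonoidAlgebra

lemma natToInt_injective (d : ℕ) : Function.Injective (natToInt d) := fun _ _ h =>
  funext fun k => Int.ofNat_injective (congrFun h k)

/-- Two decompositions of an element of `S₁ + S₂` differ by a multiple of the gluing element. -/
lemma exists_nsmul_of_add_eq_add {d : ℕ} {S₁ S₂ : AddSubmonoid (Fin d → ℕ)} {w : Fin d → ℕ}
    (hgp : AddSubgroup.closure (natToInt d '' (S₁ : Set (Fin d → ℕ)))
        ⊓ AddSubgroup.closure (natToInt d '' (S₂ : Set (Fin d → ℕ)))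
        ≤ AddSubgroup.closure {natToInt d w})
    {x x' y y' : Fin d → ℕ} (hx : x ∈ S₁) (hx' : x' ∈ S₁) (hy : y ∈ S₂) (hy' : y' ∈ S₂)
    (h : x + y = x' + y') :
    ∃ n : ℕ, (x = n • w + x' ∧ y' = n • w + y) ∨ (x' = n • w + x ∧ y = n • w + y') := by
  have hz : natToInt d x + natToInt d y = natToInt d x' + natToInt d y' := by
    rw [← map_add, h, map_add]
  have hm : natToInt d x - natToInt d x' ∈ AddSubgroup.closure {natToInt d w} := by
    refine hgp (AddSubgroup.mem_inf.2
      ⟨sub_mem (AddSubgroup.subset_closure ⟨x, hx, rfl⟩)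
        (AddSubgroup.subset_closure ⟨x', hx', rfl⟩), ?_⟩)
    rw [show natToInt d x - natToInt d x' = natToInt d y' - natToInt d y by
      rw [sub_eq_sub_iff_add_eq_add, hz, add_comm]]
    exact sub_mem (AddSubgroup.subset_closure ⟨y', hy', rfl⟩)
      (AddSubgroup.subset_closure ⟨y, hy, rfl⟩)
  obtain ⟨m, hm⟩ := AddSubgroup.mem_closure_singleton.1 hm
  obtain ⟨n, rfl | rfl⟩ := m.eq_nat_or_neg
  · have hx : x = n • w + x' := natToInt_injective d <| by
      rw [map_add, map_nsmul, ← natCast_zsmul, hm, sub_add_cancel]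
    refine ⟨n, .inl ⟨hx, ?_⟩⟩
    rw [hx, add_comm (n • w), add_assoc] at h
    exact (add_left_cancel h).symm
  · have hx : x' = n • w + x := natToInt_injective d <| by
      rw [map_add, map_nsmul, ← natCast_zsmul, ← neg_neg ((n : ℤ) • natToInt d w), ← neg_smul,
        hm, neg_sub, sub_add_cancel]
    refine ⟨n, .inr ⟨hx, ?_⟩⟩
    rw [hx, add_comm (n • w), add_assoc] at h
    exact add_left_cancel h

/-- Suppose `S₁, S₂ ⊆ ℕ^d` are submonoids and `w ∈ S₁ ∩ S₂` is a nonzero element with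
`gp(S₁) ⊓ gp(S₂) = gp({w})` in `ℤ^d`.  Let `A = {n • w : n ∈ ℕ}`.  Then there is a
`κ[A]`-algebra isomorphism `κ[S₁] ⊗_{κ[A]} κ[S₂] ≃ κ[S₁ ⊔ S₂]` sending
`u^x ⊗ u^y` to `u^{x+y}`. -/
theorem gluing_tensorProduct_iso
    (κ : Type*) [Field κ] (d : ℕ) (hd : 0 < d)
    (S₁ S₂ : AddSubmonoid (Fin d → ℕ)) (w : Fin d → ℕ)
    (hw1 : w ∈ S₁) (hw2 : w ∈ S₂) (hw0 : w ≠ 0)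
    (hgp : AddSubgroup.closure (natToInt d '' (S₁ : Set (Fin d → ℕ)))
        ⊓ AddSubgroup.closure (natToInt d '' (S₂ : Set (Fin d → ℕ)))
        = AddSubgroup.closure {natToInt d w}) :
    letI : Algebra (AddMonoidAlgebra κ ↥(AddSubmonoid.closure {w})) (AddMonoidAlgebra κ ↥S₁) :=
      (AddMonoidAlgebra.mapDomainRingHom κ (AddSubmonoid.inclusion
        (AddSubmonoid.closure_le.2 (Set.singleton_subset_iff.2 hw1)))).toAlgebra
    letI : Algebra (AddMonoidAlgebra κ ↥(AddSubmonoid.closure {w})) (AddMonoidAlgebra κ ↥S₂) :=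
      (AddMonoidAlgebra.mapDomainRingHom κ (AddSubmonoid.inclusion
        (AddSubmonoid.closure_le.2 (Set.singleton_subset_iff.2 hw2)))).toAlgebra
    letI : Algebra (AddMonoidAlgebra κ ↥(AddSubmonoid.closure {w}))
        (AddMonoidAlgebra κ ↥(S₁ ⊔ S₂)) :=
      (AddMonoidAlgebra.mapDomainRingHom κ (AddSubmonoid.inclusion
        (AddSubmonoid.closure_le.2 (Set.singleton_subset_iff.2
          ((le_sup_left : S₁ ≤ S₁ ⊔ S₂) hw1))))).toAlgebra
    ∃ e : (AddMonoidAlgebra κ ↥S₁) ⊗[AddMonoidAlgebra κ ↥(AddSubmonoid.closure {w})]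
            (AddMonoidAlgebra κ ↥S₂)
          ≃ₐ[AddMonoidAlgebra κ ↥(AddSubmonoid.closure {w})]
            AddMonoidAlgebra κ ↥(S₁ ⊔ S₂),
      ∀ (x : ↥S₁) (y : ↥S₂),
        e (AddMonoidAlgebra.single x (1 : κ) ⊗ₜ AddMonoidAlgebra.single y (1 : κ))
          = AddMonoidAlgebra.single
              (⟨(x : Fin d → ℕ) + (y : Fin d → ℕ),
                AddSubmonoid.add_mem _ ((le_sup_left : S₁ ≤ S₁ ⊔ S₂) x.2)
                  ((le_sup_right : S₂ ≤ S₁ ⊔ S₂) y.2)⟩ : ↥(S₁ ⊔ S₂)) (1 : κ) := by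
  have hA₁ : AddSubmonoid.closure {w} ≤ S₁ :=
    AddSubmonoid.closure_le.2 (Set.singleton_subset_iff.2 hw1)
  have hA₂ : AddSubmonoid.closure {w} ≤ S₂ :=
    AddSubmonoid.closure_le.2 (Set.singleton_subset_iff.2 hw2)
  have hn (n : ℕ) : n • w ∈ AddSubmonoid.closure {w} :=
    AddSubmonoid.nsmul_mem _ (AddSubmonoid.subset_closure (Set.mem_singleton w)) n
  refine AddMonoidAlgebra.exists_tensorProduct_algEquiv
    (i₁ := AddSubmonoid.inclusion hA₁) (i₂ := AddSubmonoid.inclusion hA₂)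
    (j₁ := AddSubmonoid.inclusion le_sup_left) (j₂ := AddSubmonoid.inclusion le_sup_right)
    (RingHom.algebraMap_toAlgebra _) (RingHom.algebraMap_toAlgebra _)
    (RingHom.algebraMap_toAlgebra _) rfl ?_ ?_
  · rintro ⟨n, hn⟩
    obtain ⟨x, hx, y, hy, rfl⟩ := AddSubmonoid.mem_sup.1 hn
    exact ⟨⟨x, hx⟩, ⟨y, hy⟩, rfl⟩
  · intro x x' y y' h
    obtain ⟨n, ⟨hx, hy⟩ | ⟨hx, hy⟩⟩ :=
      exists_nsmul_of_add_eq_add hgp.le x.2 x'.2 y.2 y'.2 (congrArg Subtype.val h)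
    · exact ⟨⟨n • w, hn n⟩, .inl ⟨Subtype.ext hx, Subtype.ext hy⟩⟩
    · exact ⟨⟨n • w, hn n⟩, .inr ⟨Subtype.ext hx, Subtype.ext hy⟩⟩
end
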